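/- (Proposition 2, convergence of Randomized Extended Kaczmarz.) Let X ∈ ℂ^{m×n} be a nonzero matrix with no zero rows and no zero columns, let y ∈ ℂ^m, and let β⋆ be the minimum-norm least-squares solution of X β = y (i.e. β⋆ ∈ range(X*) and X*(X β⋆ − y) = 0). Consider the Randomized Extended Kaczmarz iteration: β₀ = 0, z₀ = y; at each step t ≥ 1 independently draw a row index i_t with probability ‖X^i‖²/‖X‖_F² and a column index j_t with probability ‖X_{(j)}‖²/‖X‖_F², set z_t = z_{t−1} − (⟨X_{(j_t)}, z_{t−1}⟩/‖X_{(j_t)}‖²) X_{(j_t)} and β_t = β_{t−1} + ((y_{i_t} − (z_t)_{i_t} − X^{i_t} β_{t−1})/‖X^{i_t}‖²)(X^{i_t})*. Then for every t ≥ 0, 𝔼‖β_t − β⋆‖² ≤ α_X^{⌊t/2⌋}(1 + 2 κ_X²)‖β⋆‖², where α_X := 1 − σ_min(X)²/‖X‖_F² and κ_X² := σ_max(X)²/σ_min(X)². -/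

import Mathlib

open Matrix Finset

noncomputable section

/-- Squared Euclidean norm of a complex vector. -/
def vnsq {n : ℕ} (x : Fin n → ℂ) : ℝ := ∑ i, ‖x i‖ ^ 2

/-- Squared Frobenius norm of a complex matrix. -/
def froSq {m n : ℕ} (A : Matrix (Fin m) (Fin n) ℂ) : ℝ := ∑ i, vnsq (A i)

/-- Square of the smallest nonzero singular value of `A`: the infimum of `‖A x‖²`
over unit vectors `x` in the row space of `A`. -/
def sMinSq {m n : ℕ} (A : Matrix (Fin m) (Fin n) ℂ) : ℝ :=
  sInf {r : ℝ | ∃ u : Fin m → ℂ, vnsq (Aᴴ.mulVec u) = 1 ∧ r = vnsq (A.mulVec (Aᴴ.mulVec u))}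

/-- Square of the largest singular value of `A`. -/
def sMaxSq {m n : ℕ} (A : Matrix (Fin m) (Fin n) ℂ) : ℝ :=
  sSup {r : ℝ | ∃ x : Fin n → ℂ, vnsq x = 1 ∧ r = vnsq (A.mulVec x)}

/-- `α_A := 1 - σ_min(A)²/‖A‖_F²`. -/
def alphaOf {m n : ℕ} (A : Matrix (Fin m) (Fin n) ℂ) : ℝ := 1 - sMinSq A / froSq A

/-- Expectation of `g` of the state after `t` steps of a Markov chain whose step at each
time uses an independent draw from the finite set `D` with probability weights `w`,
started at `init`, with transition `step`. -/
def markovExp {S D : Type*} [Fintype D] (w : D → ℝ) (step : D → S → S) (init : S) :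
    ℕ → (S → ℝ) → ℝ
  | 0, g => g init
  | t + 1, g => markovExp w step init t (fun s => ∑ d, w d * g (step d s))

lemma vnsq_nonneg {n : ℕ} (x : Fin n → ℂ) : 0 ≤ vnsq x :=
  Finset.sum_nonneg fun _ _ => by positivity

lemma vnsq_pos {n : ℕ} {x : Fin n → ℂ} (h : x ≠ 0) : 0 < vnsq x := by
  obtain ⟨i, hi⟩ := Function.ne_iff.mp h
  refine Finset.sum_pos' (fun _ _ => by positivity) ⟨i, Finset.mem_univ _, ?_⟩
  have : 0 < ‖x i‖ := norm_pos_iff.mpr hi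
  positivity

lemma vnsq_zero {n : ℕ} : vnsq (0 : Fin n → ℂ) = 0 := by simp [vnsq]

lemma vnsq_smul {n : ℕ} (c : ℂ) (x : Fin n → ℂ) : vnsq (c • x) = ‖c‖ ^ 2 * vnsq x := by
  simp [vnsq, mul_pow, Finset.mul_sum]

lemma vnsq_star {n : ℕ} (x : Fin n → ℂ) : vnsq (fun i => star (x i)) = vnsq x := by
  simp [vnsq]

lemma cs_vnsq {n : ℕ} (a b : Fin n → ℂ) : ‖∑ i, a i * b i‖ ^ 2 ≤ vnsq a * vnsq b := by
  have h1 : ‖∑ i, a i * b i‖ ≤ ∑ i, ‖a i‖ * ‖b i‖ :=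
    (norm_sum_le _ _).trans (by simp)
  calc _ ≤ (∑ i, ‖a i‖ * ‖b i‖) ^ 2 := by gcongr
    _ ≤ _ := Finset.sum_mul_sq_le_sq_mul_sq _ _ _

lemma vnsq_mulVec_le {m n : ℕ} (A : Matrix (Fin m) (Fin n) ℂ) (x : Fin n → ℂ) :
    vnsq (A.mulVec x) ≤ froSq A * vnsq x := by
  unfold froSq
  rw [Finset.sum_mul]
  conv_lhs => unfold vnsq
  exact Finset.sum_le_sum fun i _ => cs_vnsq (A i) x

lemma froSq_nonneg {m n : ℕ} (A : Matrix (Fin m) (Fin n) ℂ) : 0 ≤ froSq A :=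
  Finset.sum_nonneg fun _ _ => vnsq_nonneg _

lemma froSq_cols {m n : ℕ} (A : Matrix (Fin m) (Fin n) ℂ) :
    ∑ j, vnsq (fun i => A i j) = froSq A := by
  unfold froSq vnsq
  rw [Finset.sum_comm]

lemma vnsq_mulVec_le_sMax {m n : ℕ} (A : Matrix (Fin m) (Fin n) ℂ) (x : Fin n → ℂ) :
    vnsq (A.mulVec x) ≤ sMaxSq A * vnsq x := by
  by_cases hx : x = 0
  · subst hx; simp [vnsq_zero]
  have hp := vnsq_pos hx
  set c : ℂ := (((Real.sqrt (vnsq x))⁻¹ : ℝ) : ℂ) with hc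
  have hc2 : ‖c‖ ^ 2 = (vnsq x)⁻¹ := by
    rw [hc, Complex.norm_real, Real.norm_eq_abs, sq_abs, inv_pow, Real.sq_sqrt hp.le]
  have : vnsq (A.mulVec (c • x)) ≤ sMaxSq A := by
    refine le_csSup ⟨froSq A, ?_⟩ ⟨c • x, ?_, rfl⟩
    · rintro r ⟨z, hz, rfl⟩
      simpa [hz] using vnsq_mulVec_le A z
    · rw [vnsq_smul, hc2, inv_mul_cancel₀ hp.ne']
  rw [Matrix.mulVec_smul, vnsq_smul, hc2, inv_mul_le_iff₀ hp] at this
  linarith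

lemma sMin_le {m n : ℕ} (A : Matrix (Fin m) (Fin n) ℂ) (u : Fin m → ℂ) :
    sMinSq A * vnsq (Aᴴ.mulVec u) ≤ vnsq (A.mulVec (Aᴴ.mulVec u)) := by
  by_cases hx : Aᴴ.mulVec u = 0
  · simp [hx, vnsq_zero]
  have hp := vnsq_pos hx
  set x := Aᴴ.mulVec u with hxd
  set c : ℂ := (((Real.sqrt (vnsq x))⁻¹ : ℝ) : ℂ) with hc
  have hc2 : ‖c‖ ^ 2 = (vnsq x)⁻¹ := by
    rw [hc, Complex.norm_real, Real.norm_eq_abs, sq_abs, inv_pow, Real.sq_sqrt hp.le]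
  have : sMinSq A ≤ vnsq (A.mulVec (c • x)) := by
    refine csInf_le ⟨0, ?_⟩ ⟨c • u, ?_, ?_⟩
    · rintro r ⟨z, hz, rfl⟩
      exact vnsq_nonneg _
    · rw [Matrix.mulVec_smul, vnsq_smul, hc2, inv_mul_cancel₀ hp.ne']
    · rw [Matrix.mulVec_smul Aᴴ]
  rw [Matrix.mulVec_smul, vnsq_smul, hc2, le_inv_mul_iff₀ hp] at this
  linarith

open scoped ComplexOrder in
lemma exists_pinv {m n : ℕ} (A : Matrix (Fin m) (Fin n) ℂ) :
    ∃ B : Matrix (Fin n) (Fin m) ℂ, B * (A * Aᴴ) = Aᴴ := by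
  let V := LinearMap.range (Aᴴ).mulVecLin
  let f : V →ₗ[ℂ] (Fin m → ℂ) := A.mulVecLin.comp V.subtype
  have hf : LinearMap.ker f = ⊥ := by
    rw [LinearMap.ker_eq_bot']
    rintro ⟨v, u, rfl⟩ h
    have h' : (A * Aᴴ).mulVec u = 0 := by
      simpa [f, Matrix.mulVec_mulVec] using h
    rw [Matrix.self_mul_conjTranspose_mulVec_eq_zero] at h'
    ext1
    simpa using h'
  obtain ⟨g, hg⟩ := f.exists_leftInverse_of_injective hf
  refine ⟨LinearMap.toMatrix' (V.subtype.comp g), ?_⟩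
  apply Matrix.mulVec_injective
  funext u
  rw [← Matrix.mulVec_mulVec, LinearMap.toMatrix'_mulVec]
  have h1 : (A * Aᴴ).mulVec u = f ⟨Aᴴ.mulVec u, u, rfl⟩ := by
    simp [f, Matrix.mulVec_mulVec]
  rw [h1, LinearMap.comp_apply, ← LinearMap.comp_apply g f, hg]
  rfl

lemma sMin_pos {m n : ℕ} (A : Matrix (Fin m) (Fin n) ℂ) (hA : A ≠ 0) : 0 < sMinSq A := by
  obtain ⟨B, hB⟩ := exists_pinv A
  have key : ∀ u, vnsq (Aᴴ.mulVec u) ≤ froSq B * vnsq (A.mulVec (Aᴴ.mulVec u)) := by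
    intro u
    have := vnsq_mulVec_le B (A.mulVec (Aᴴ.mulVec u))
    rwa [Matrix.mulVec_mulVec, Matrix.mulVec_mulVec,
      Matrix.mul_assoc, hB] at this
  have hA' : ∃ u, Aᴴ.mulVec u ≠ 0 := by
    by_contra! h
    apply hA
    have : Aᴴ = 0 := by
      apply Matrix.mulVec_injective
      funext u
      simp [h u]
    simpa using this
  obtain ⟨u, hu⟩ := hA'
  have hp := vnsq_pos hu
  have hBp : 0 < froSq B := by
    by_contra! h
    have h0 : froSq B = 0 := le_antisymm h (froSq_nonneg B)
    have := key u
    rw [h0, zero_mul] at this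
    linarith
  refine lt_of_lt_of_le (inv_pos.mpr hBp) (le_csInf ?_ ?_)
  · set c : ℂ := (((Real.sqrt (vnsq (Aᴴ.mulVec u)))⁻¹ : ℝ) : ℂ) with hc
    have hc2 : ‖c‖ ^ 2 = (vnsq (Aᴴ.mulVec u))⁻¹ := by
      rw [hc, Complex.norm_real, Real.norm_eq_abs, sq_abs, inv_pow, Real.sq_sqrt hp.le]
    refine ⟨_, c • u, ?_, rfl⟩
    rw [Matrix.mulVec_smul, vnsq_smul, hc2, inv_mul_cancel₀ hp.ne']
  · rintro r ⟨z, hz, rfl⟩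
    have := key z
    rw [hz] at this
    rwa [inv_le_iff_one_le_mul₀' hBp]

lemma vnsq_dot {n : ℕ} (x : Fin n → ℂ) : (vnsq x : ℂ) = star x ⬝ᵥ x := by
  simp only [vnsq, dotProduct, Pi.star_apply]
  push_cast
  refine Finset.sum_congr rfl fun i _ => ?_
  rw [← Complex.conj_mul']; rfl

/-- The dual bound on the column space. -/
lemma sMin_le_dual {m n : ℕ} (A : Matrix (Fin m) (Fin n) ℂ) (hA : A ≠ 0) (u : Fin n → ℂ) :
    sMinSq A * vnsq (A.mulVec u) ≤ vnsq (Aᴴ.mulVec (A.mulVec u)) := by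
  obtain ⟨B, hB⟩ := exists_pinv A
  have hB' : A * Aᴴ * Bᴴ = A := by
    have := congrArg Matrix.conjTranspose hB
    simpa [Matrix.conjTranspose_mul] using this
  have h1 : A.mulVec u = A.mulVec (Aᴴ.mulVec (Bᴴ.mulVec u)) := by
    rw [Matrix.mulVec_mulVec, Matrix.mulVec_mulVec, hB']
  set p := Bᴴ.mulVec u
  have hs := sMin_pos A hA
  have h2 := sMin_le A p
  rw [h1]
  set x := Aᴴ.mulVec p
  set v := A.mulVec x
  have h3 : (vnsq v : ℂ) = ∑ i, (star (Aᴴ.mulVec v)) i * x i := by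
    rw [vnsq_dot]
    change star v ⬝ᵥ A.mulVec x = star (Aᴴ.mulVec v) ⬝ᵥ x
    rw [Matrix.star_mulVec Aᴴ v, Matrix.conjTranspose_conjTranspose, Matrix.dotProduct_mulVec]
  have h4 := cs_vnsq (star (Aᴴ.mulVec v)) x
  rw [← h3, Complex.norm_real, Real.norm_eq_abs, sq_abs] at h4
  have h5 : vnsq (star (Aᴴ.mulVec v)) = vnsq (Aᴴ.mulVec v) := vnsq_star _
  rw [h5] at h4
  have hv := vnsq_nonneg v
  have hw := vnsq_nonneg (Aᴴ.mulVec v)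
  rcases hv.eq_or_lt with h0 | h0
  · rw [← h0, mul_zero]; exact hw
  · refine le_of_mul_le_mul_right ?_ h0
    nlinarith

/-- One projection step. -/
lemma vnsq_step {n : ℕ} (a e : Fin n → ℂ) (c : ℂ) (ha : a ≠ 0) :
    vnsq (fun l => e l + (c - ∑ q, a q * e q) / (vnsq a : ℂ) * star (a l))
      = vnsq e - ‖∑ q, a q * e q‖ ^ 2 / vnsq a + ‖c‖ ^ 2 / vnsq a := by
  have hN := vnsq_pos ha
  have hN' : (vnsq a : ℂ) ≠ 0 := by exact_mod_cast hN.ne'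
  set p := ∑ q, a q * e q with hp
  set k := (c - p) / (vnsq a : ℂ) with hk
  have hsp : star p = ∑ q, star (a q) * star (e q) := by
    rw [hp, star_sum]; simp
  have hkN : k * vnsq a = c - p := by rw [hk]; field_simp
  have hskN : star k * vnsq a = star c - star p := by
    have := congrArg star hkN
    simpa using this
  have hnn : ∀ z : ℂ, ((‖z‖ : ℂ)) ^ 2 = star z * z := fun z => (Complex.conj_mul' z).symm
  have e1 : (vnsq (fun l => e l + k * star (a l)) : ℂ)
      = vnsq e + k * star p + star k * p + star k * k * vnsq a := by
    rw [hsp, hp]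
    simp only [vnsq]
    push_cast
    simp only [hnn, Finset.mul_sum, ← Finset.sum_add_distrib]
    refine Finset.sum_congr rfl fun i _ => ?_
    simp only [star_add, star_mul', star_star]
    ring
  have : (vnsq (fun l => e l + k * star (a l)) : ℂ)
      = ((vnsq e - ‖p‖ ^ 2 / vnsq a + ‖c‖ ^ 2 / vnsq a : ℝ) : ℂ) := by
    rw [e1]
    push_cast
    rw [hnn, hnn]
    apply mul_right_cancel₀ hN'
    field_simp
    have hk2 : (vnsq a : ℂ) * k = c - p := by rw [mul_comm]; exact hkN
    have hk3 : (vnsq a : ℂ) * star k = star c - star p := by rw [mul_comm]; exact hskN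
    linear_combination (star p + star k * (vnsq a : ℂ)) * hkN + (p + (c - p)) * hskN
  exact_mod_cast this

section Markov
variable {S D : Type*} [Fintype D] (w : D → ℝ) (step : D → S → S) (init : S)

lemma markovExp_add (t : ℕ) : ∀ (g h : S → ℝ), markovExp w step init t (fun s => g s + h s)
    = markovExp w step init t g + markovExp w step init t h := by
  induction t with
  | zero => intro g h; rfl
  | succ t ih =>
    intro g h
    simp only [markovExp, mul_add, Finset.sum_add_distrib]
    exact ih _ _

lemma markovExp_smul (c : ℝ) (t : ℕ) : ∀ (g : S → ℝ), markovExp w step init t (fun s => c * g s)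
    = c * markovExp w step init t g := by
  induction t with
  | zero => intro g; rfl
  | succ t ih =>
    intro g
    simp only [markovExp]
    rw [← ih]
    congr 1
    funext s
    rw [Finset.mul_sum]
    exact Finset.sum_congr rfl fun _ _ => by ring

lemma markovExp_mono (Inv : S → Prop) (hw : ∀ d, 0 ≤ w d) (h0 : Inv init)
    (hs : ∀ d s, Inv s → Inv (step d s)) (t : ℕ) : ∀ (g h : S → ℝ),
    (∀ s, Inv s → g s ≤ h s) → markovExp w step init t g ≤ markovExp w step init t h := by
  induction t with
  | zero => intro g h H; exact H _ h0
  | succ t ih =>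
    intro g h H
    simp only [markovExp]
    exact ih _ _ fun s hI => Finset.sum_le_sum fun d _ =>
      mul_le_mul_of_nonneg_left (H _ (hs d s hI)) (hw d)

/-- Coupled linear recursions. -/
lemma markovExp_bound (Inv : S → Prop) (hw : ∀ d, 0 ≤ w d) (h0 : Inv init)
    (hs : ∀ d s, Inv s → Inv (step d s)) (g h : S → ℝ) (α c : ℝ) (hα : 0 ≤ α) (hc : 0 ≤ c)
    (H1 : ∀ s, Inv s → ∑ d, w d * h (step d s) ≤ α * h s)
    (H2 : ∀ s, Inv s → ∑ d, w d * g (step d s) ≤ α * g s + c * ∑ d, w d * h (step d s))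
    (t : ℕ) :
    markovExp w step init t h ≤ α ^ t * h init ∧
    markovExp w step init t g ≤ α ^ t * g init + c * t * α ^ t * h init := by
  induction t with
  | zero => simp [markovExp]
  | succ t ih =>
    have A1 : markovExp w step init (t + 1) h ≤ α ^ (t + 1) * h init := by
      have := markovExp_mono w step init Inv hw h0 hs t _ _ H1
      rw [markovExp_smul] at this
      calc _ ≤ _ := this
        _ ≤ α * (α ^ t * h init) := by gcongr; exact ih.1
        _ = _ := by ring
    refine ⟨A1, ?_⟩
    have := markovExp_mono w step init Inv hw h0 hs t _ _ H2
    rw [markovExp_add, markovExp_smul, markovExp_smul] at this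
    calc _ ≤ _ := this
      _ ≤ α * (α ^ t * g init + c * t * α ^ t * h init) + c * (α ^ (t + 1) * h init) := by
        gcongr
        · exact ih.2
        · exact A1
      _ = _ := by push_cast; ring
end Markov

lemma pow_aux (α : ℝ) (h0 : 0 ≤ α) (h1 : α ≤ 1) (t : ℕ) :
    (t : ℝ) * α ^ t * (1 - α) ≤ 2 * α ^ (t / 2) := by
  obtain ⟨k, hk, hkt⟩ : ∃ k, t = t / 2 + k ∧ t ≤ 2 * k := ⟨t - t / 2, by omega, by omega⟩
  have a1 : (k : ℝ) * α ^ k ≤ ∑ j ∈ Finset.range k, α ^ j := by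
    have := Finset.card_nsmul_le_sum (Finset.range k) (fun j => α ^ j) (α ^ k)
      (fun j hj => pow_le_pow_of_le_one h0 h1 (Finset.mem_range.mp hj).le)
    simpa using this
  have a2 : (∑ j ∈ Finset.range k, α ^ j) * (1 - α) = 1 - α ^ k := by
    have := geom_sum_mul α k
    linarith
  have a3 : (k : ℝ) * α ^ k * (1 - α) ≤ 1 := by
    have := mul_le_mul_of_nonneg_right a1 (sub_nonneg.mpr h1)
    have := pow_nonneg h0 k
    linarith
  have a4 : (t : ℝ) ≤ 2 * k := by exact_mod_cast hkt
  have e : α ^ t = α ^ (t / 2) * α ^ k := by rw [← pow_add, ← hk]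
  have p1 := pow_nonneg h0 k
  have p2 := pow_nonneg h0 (t / 2)
  calc (t : ℝ) * α ^ t * (1 - α) = t * (α ^ (t / 2) * α ^ k * (1 - α)) := by rw [e]; ring
    _ ≤ (2 * k) * (α ^ (t / 2) * α ^ k * (1 - α)) := by
      have := sub_nonneg.mpr h1
      gcongr
    _ = 2 * α ^ (t / 2) * (k * α ^ k * (1 - α)) := by ring
    _ ≤ 2 * α ^ (t / 2) * 1 := by gcongr
    _ = _ := by ring

/-- **Proposition 2 (convergence of Randomized Extended Kaczmarz).**
`X` nonzero with no zero rows or columns, `β⋆` the minimum-norm least-squares solution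
of `X β = y` (`β⋆ ∈ range(Xᴴ)` and `Xᴴ(X β⋆ − y) = 0`).  The REK iteration starts at
`β₀ = 0`, `z₀ = y`; at each step it independently draws a row `i` with probability
`‖X^i‖²/‖X‖_F²` and a column `j` with probability `‖X_{(j)}‖²/‖X‖_F²`, updates `z` and
then `β` (using the fresh `z_t`).  Then
`𝔼‖β_t − β⋆‖² ≤ α_X^{⌊t/2⌋} (1 + 2 κ_X²) ‖β⋆‖²`. -/
theorem rek_convergence
    (m n : ℕ) (X : Matrix (Fin m) (Fin n) ℂ)
    (hX : X ≠ 0) (hrows : ∀ i, X i ≠ 0) (hcols : ∀ j, (fun i => X i j) ≠ 0)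
    (y : Fin m → ℂ) (βs : Fin n → ℂ)
    (hβs : ∃ w : Fin m → ℂ, Xᴴ.mulVec w = βs)        -- β⋆ ∈ range(Xᴴ)
    (hls : Xᴴ.mulVec (X.mulVec βs - y) = 0)           -- normal equations
    (t : ℕ) :
    markovExp
      (fun d : Fin m × Fin n =>
        (vnsq (X d.1) / froSq X) * (vnsq (fun i => X i d.2) / froSq X))
      (fun d s =>
        let i := d.1; let j := d.2
        let z' : Fin m → ℂ := fun r =>
          s.1 r - (∑ q, star (X q j) * s.1 q) / (vnsq (fun q => X q j) : ℂ) * X r j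
        let β' : Fin n → ℂ := fun l =>
          s.2 l + (y i - z' i - X.mulVec s.2 i) / (vnsq (X i) : ℂ) * star (X i l)
        (z', β'))
      (y, (0 : Fin n → ℂ))
      t
      (fun s => vnsq (s.2 - βs))
    ≤ (alphaOf X) ^ (t / 2) * (1 + 2 * (sMaxSq X / sMinSq X)) * vnsq βs := by
  have hs := sMin_pos X hX
  set F := froSq X with hF
  set r : Fin m → ℂ := y - X.mulVec βs with hr
  have hXr : Xᴴ.mulVec r = 0 := by
    rw [hr, ← neg_sub, Matrix.mulVec_neg, hls, neg_zero]
  have hXrj : ∀ j, ∑ q, star (X q j) * r q = 0 := fun j => congrFun hXr j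
  have hFpos : 0 < F := by
    obtain ⟨i, -⟩ := Function.ne_iff.mp hX
    exact Finset.sum_pos (fun i _ => vnsq_pos (hrows i)) ⟨i, Finset.mem_univ _⟩
  have hsF : sMinSq X ≤ F := by
    obtain ⟨u, hu⟩ : ∃ u, Xᴴ.mulVec u ≠ 0 := by
      by_contra! h
      apply hX
      have : Xᴴ = 0 := by
        apply Matrix.mulVec_injective
        funext u
        simp [h u]
      simpa using this
    exact le_of_mul_le_mul_right ((sMin_le X u).trans (vnsq_mulVec_le X _)) (vnsq_pos hu)
  have hα0 : 0 ≤ alphaOf X := by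
    unfold alphaOf; rw [sub_nonneg, div_le_one hFpos]; exact hsF
  have hα1 : alphaOf X ≤ 1 := by
    unfold alphaOf
    have : 0 ≤ sMinSq X / froSq X := by positivity
    linarith
  have h1α : 1 - alphaOf X = sMinSq X / F := by unfold alphaOf; ring
  have hp1 : ∑ i, vnsq (X i) / F = 1 := by
    rw [← Finset.sum_div]; exact div_self hFpos.ne'
  have hq1 : ∑ j, vnsq (fun i => X i j) / F = 1 := by
    rw [← Finset.sum_div, froSq_cols]; exact div_self hFpos.ne'
  -- the column step
  let zs : Fin n → (Fin m → ℂ) → (Fin m → ℂ) := fun j z r =>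
    z r - (∑ q, star (X q j) * z q) / (vnsq (fun q => X q j) : ℂ) * X r j
  have hz : ∀ j z, vnsq (zs j z - r) = vnsq (z - r)
      - ‖(Xᴴ.mulVec (z - r)) j‖ ^ 2 / vnsq (fun q => X q j) := by
    intro j z
    have hne : (fun q => star (X q j)) ≠ 0 := by
      intro h
      apply hcols j
      funext q
      simpa using congrFun h q
    have := vnsq_step (fun q => star (X q j)) (z - r) 0 hne
    have e1 : ∑ q, star (X q j) * (z - r) q = ∑ q, star (X q j) * z q := by
      simp only [Pi.sub_apply, mul_sub, Finset.sum_sub_distrib, hXrj, sub_zero]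
    have e2 : (Xᴴ.mulVec (z - r)) j = ∑ q, star (X q j) * (z - r) q := rfl
    have e3 : vnsq (fun q => star (X q j)) = vnsq (fun q => X q j) := vnsq_star _
    rw [e2]
    simp only [e3, norm_zero, star_star] at this
    rw [e1] at this ⊢
    have e4 : vnsq (z - r) - ‖∑ q, star (X q j) * z q‖ ^ 2 / vnsq (fun q => X q j)
        = vnsq (z - r) - ‖∑ q, star (X q j) * z q‖ ^ 2 / vnsq (fun q => X q j)
          + 0 ^ 2 / vnsq (fun q => X q j) := by ring
    rw [e4, ← this]
    congr 1
    funext l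
    simp only [zs, Pi.sub_apply]
    ring
  have hzsum : ∀ z, ∑ j, vnsq (fun i => X i j) / F * vnsq (zs j z - r)
      = vnsq (z - r) - vnsq (Xᴴ.mulVec (z - r)) / F := by
    intro z
    have : ∀ j, vnsq (fun i => X i j) / F * vnsq (zs j z - r)
        = vnsq (fun i => X i j) / F * vnsq (z - r) - ‖(Xᴴ.mulVec (z - r)) j‖ ^ 2 / F := by
      intro j
      have := vnsq_pos (hcols j)
      rw [hz]; field_simp
    simp only [this, Finset.sum_sub_distrib]
    rw [← Finset.sum_mul, hq1, one_mul, ← Finset.sum_div]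
    rfl
  -- the row step
  let bs : Fin m → (Fin m → ℂ) → (Fin n → ℂ) → (Fin n → ℂ) := fun i z b l =>
    b l + (y i - z i - X.mulVec b i) / (vnsq (X i) : ℂ) * star (X i l)
  have hb : ∀ i z b, vnsq (bs i z b - βs) = vnsq (b - βs)
      - ‖(X.mulVec (b - βs)) i‖ ^ 2 / vnsq (X i) + ‖(z - r) i‖ ^ 2 / vnsq (X i) := by
    intro i z b
    have := vnsq_step (X i) (b - βs) (-(z - r) i) (hrows i)
    rw [norm_neg] at this
    have e2 : (X.mulVec (b - βs)) i = ∑ q, X i q * (b - βs) q := rfl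
    rw [e2, ← this]
    congr 1
    funext l
    have e3 : y i - z i - X.mulVec b i = -(z - r) i - ∑ q, X i q * (b - βs) q := by
      rw [← e2, Matrix.mulVec_sub, hr]
      simp only [Pi.sub_apply]
      ring
    simp only [bs, Pi.sub_apply] at *
    rw [e3]
    ring
  have hbsum : ∀ z b, ∑ i, vnsq (X i) / F * vnsq (bs i z b - βs)
      = vnsq (b - βs) - vnsq (X.mulVec (b - βs)) / F + vnsq (z - r) / F := by
    intro z b
    have : ∀ i, vnsq (X i) / F * vnsq (bs i z b - βs)
        = vnsq (X i) / F * vnsq (b - βs) - ‖(X.mulVec (b - βs)) i‖ ^ 2 / F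
          + ‖(z - r) i‖ ^ 2 / F := by
      intro i
      have := vnsq_pos (hrows i)
      rw [hb]; field_simp
    simp only [this, Finset.sum_sub_distrib, Finset.sum_add_distrib]
    rw [← Finset.sum_mul, hp1, one_mul, ← Finset.sum_div, ← Finset.sum_div]
    rfl
  obtain ⟨w0, hw0⟩ := hβs
  let Inv : (Fin m → ℂ) × (Fin n → ℂ) → Prop := fun s =>
    (∃ u, X.mulVec u = s.1 - r) ∧ ∃ v, Xᴴ.mulVec v = s.2 - βs
  have hI0 : Inv (y, 0) := by
    refine ⟨⟨βs, ?_⟩, ⟨-w0, ?_⟩⟩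
    · simp [hr]
    · simp [Matrix.mulVec_neg, hw0]
  have hIs : ∀ (d : Fin m × Fin n) s, Inv s →
      Inv (zs d.2 s.1, bs d.1 (zs d.2 s.1) s.2) := by
    rintro ⟨i, j⟩ ⟨z, b⟩ ⟨⟨u, hu⟩, ⟨v, hv⟩⟩
    simp only at hu hv
    refine ⟨⟨u - Pi.single j
      ((∑ q, star (X q j) * z q) / (vnsq (fun q => X q j) : ℂ)), ?_⟩,
      ⟨v + Pi.single i ((y i - zs j z i - X.mulVec b i) / (vnsq (X i) : ℂ)), ?_⟩⟩
    · rw [Matrix.mulVec_sub, hu, Matrix.mulVec_single]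
      funext l
      simp [zs]
      ring
    · rw [Matrix.mulVec_add, hv, Matrix.mulVec_single]
      funext l
      simp [bs]
      ring
  have hsplit : ∀ f : Fin m → Fin n → ℝ, ∑ d : Fin m × Fin n,
      (vnsq (X d.1) / F) * (vnsq (fun i => X i d.2) / F) * f d.1 d.2
      = ∑ j, vnsq (fun i => X i j) / F * ∑ i, vnsq (X i) / F * f i j := by
    intro f
    rw [Fintype.sum_prod_type_right]
    refine Finset.sum_congr rfl fun j _ => ?_
    rw [Finset.mul_sum]
    exact Finset.sum_congr rfl fun i _ => by ring
  have hTh : ∀ s : (Fin m → ℂ) × (Fin n → ℂ), ∑ d : Fin m × Fin n,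
      (vnsq (X d.1) / F) * (vnsq (fun i => X i d.2) / F) * vnsq (zs d.2 s.1 - r)
      = vnsq (s.1 - r) - vnsq (Xᴴ.mulVec (s.1 - r)) / F := by
    intro s
    rw [hsplit (fun _ j => vnsq (zs j s.1 - r)), ← hzsum]
    refine Finset.sum_congr rfl fun j _ => ?_
    rw [← Finset.sum_mul, hp1, one_mul]
  have main := markovExp_bound
    (fun d : Fin m × Fin n => (vnsq (X d.1) / F) * (vnsq (fun i => X i d.2) / F))
    (fun d s => (zs d.2 s.1, bs d.1 (zs d.2 s.1) s.2)) (y, (0 : Fin n → ℂ)) Inv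
    (fun d => mul_nonneg (div_nonneg (vnsq_nonneg _) hFpos.le)
      (div_nonneg (vnsq_nonneg _) hFpos.le)) hI0 hIs
    (fun s => vnsq (s.2 - βs)) (fun s => vnsq (s.1 - r)) (alphaOf X) (1 / F) hα0 (by positivity)
    (by
      rintro s ⟨⟨u, hu⟩, -⟩
      refine (hTh s).le.trans ?_
      have := sMin_le_dual X hX u
      rw [hu] at this
      have h2 := div_le_div_of_nonneg_right this hFpos.le
      have h3 : alphaOf X * vnsq (s.1 - r)
        = vnsq (s.1 - r) - sMinSq X * vnsq (s.1 - r) / F := by unfold alphaOf; ring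
      simp only [h3]
      linarith)
    (by
      rintro s ⟨-, ⟨v, hv⟩⟩
      have e1 := hTh s
      have e2 := hsplit (fun i j => vnsq (bs i (zs j s.1) s.2 - βs))
      simp only [hbsum] at e2
      have e3 := hzsum s.1
      have e4 : ∑ j, vnsq (fun i => X i j) / F *
          (vnsq (s.2 - βs) - vnsq (X.mulVec (s.2 - βs)) / F + vnsq (zs j s.1 - r) / F)
          = (vnsq (s.2 - βs) - vnsq (X.mulVec (s.2 - βs)) / F)
            + 1 / F * ∑ j, vnsq (fun i => X i j) / F * vnsq (zs j s.1 - r) := by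
        simp only [mul_add, Finset.sum_add_distrib]
        rw [← Finset.sum_mul, hq1, one_mul, Finset.mul_sum]
        congr 1
        exact Finset.sum_congr rfl fun j _ => by ring
      rw [e4, e3, ← e1] at e2
      refine e2.le.trans ?_
      have := sMin_le X v
      rw [hv] at this
      have h2 := div_le_div_of_nonneg_right this hFpos.le
      have h3 : alphaOf X * vnsq (s.2 - βs)
        = vnsq (s.2 - βs) - sMinSq X * vnsq (s.2 - βs) / F := by unfold alphaOf; ring
      simp only [h3]
      linarith) t
  refine main.2.trans ?_
  have hi1 : vnsq ((0 : Fin n → ℂ) - βs) = vnsq βs := by simp [vnsq]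
  have hi2 : vnsq (y - r) ≤ sMaxSq X * vnsq βs := by
    rw [hr, sub_sub_cancel]; exact vnsq_mulVec_le_sMax X βs
  simp only [hi1]
  have hb0 := vnsq_nonneg βs
  have hM : 0 ≤ sMaxSq X * vnsq βs := (vnsq_nonneg _).trans hi2
  have hpa := pow_aux (alphaOf X) hα0 hα1 t
  rw [h1α] at hpa
  have c1 : 1 / F * t * alphaOf X ^ t ≤ 2 * alphaOf X ^ (t / 2) / sMinSq X := by
    rw [le_div_iff₀ hs]
    calc _ = t * alphaOf X ^ t * (sMinSq X / F) := by ring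
      _ ≤ _ := hpa
  have c2 : alphaOf X ^ t ≤ alphaOf X ^ (t / 2) :=
    pow_le_pow_of_le_one hα0 hα1 (Nat.div_le_self _ _)
  calc alphaOf X ^ t * vnsq βs + 1 / F * t * alphaOf X ^ t * vnsq (y - r)
      ≤ alphaOf X ^ (t / 2) * vnsq βs
        + 2 * alphaOf X ^ (t / 2) / sMinSq X * (sMaxSq X * vnsq βs) := by
        have : 0 ≤ 1 / F * t * alphaOf X ^ t := by positivity
        have := vnsq_nonneg (y - r)
        gcongr
    _ = _ := by ring
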